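/- arXiv:0903.0799 — 4 statements merged into one kernel-verified Lean document; each statement's English description precedes it below -/
import Mathlib

section
/- Let p > 2 and let h ∈ C²(K⁻) be a twice continuously differentiable function on the backward light-cone K⁻. Then the function Ω · (h ∘ Φ) on K⁺ is of class C² and satisfies, in null coordinates 0 < v < u, the identity □( Ω · (h∘Φ) ) = (p−2)² (uv)^{−(p−1)} Ω · ( (□h) ∘ Φ ) on K⁺. -/
/-- Partial derivative in the time variable `t` of a function of `(t, r)`. -/
noncomputable def pdt (f : ℝ → ℝ → ℝ) (t r : ℝ) : ℝ := deriv (fun s => f s r) t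

/-- Partial derivative in the radial variable `r` of a function of `(t, r)`. -/
noncomputable def pdr (f : ℝ → ℝ → ℝ) (t r : ℝ) : ℝ := deriv (fun s => f t s) r

/-- Radial d'Alembertian `□f = ∂_t²f − ∂_r²f − (2/r)∂_r f` for `r > 0`. -/
noncomputable def dAlembert (f : ℝ → ℝ → ℝ) (t r : ℝ) : ℝ :=
  pdt (pdt f) t r - pdr (pdr f) t r - (2 / r) * pdr f t r

/-- Time coordinate of `Φ(t,r)`, where in null coordinates `u = t + r`,
`v = t − r` the map is `Φ(u,v) = (−u^{−(p−2)}, −v^{−(p−2)})`. -/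
noncomputable def PhiT (p t r : ℝ) : ℝ :=
  (-(t + r) ^ (-(p - 2)) + -(t - r) ^ (-(p - 2))) / 2

/-- Radial coordinate of `Φ(t,r)`. -/
noncomputable def PhiR (p t r : ℝ) : ℝ :=
  (-(t + r) ^ (-(p - 2)) - -(t - r) ^ (-(p - 2))) / 2

/-- The conformal factor `Ω(u,v) = (v^{−(p−2)} − u^{−(p−2)})/(u − v)` written
in the coordinates `(t,r)`, with `u − v = 2r`. -/
noncomputable def Omega (p t r : ℝ) : ℝ :=
  ((t - r) ^ (-(p - 2)) - (t + r) ^ (-(p - 2))) / (2 * r)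

theorem deriv_deriv_comp {E : Type*} [NormedAddCommGroup E] [NormedSpace ℝ E]
    {G : E → ℝ} {γ γ' : ℝ → E} {γ'' : E} {s : ℝ} (hG : ContDiffAt ℝ 2 G (γ s))
    (hγ : ∀ᶠ x in nhds s, HasDerivAt γ (γ' x) x) (hγ' : HasDerivAt γ' γ'' s) :
    deriv (deriv fun x => G (γ x)) s =
      fderiv ℝ (fderiv ℝ G) (γ s) (γ' s) (γ' s) + fderiv ℝ G (γ s) γ'' := by
  have hev : ∀ᶠ x in nhds s, ContDiffAt ℝ 2 G (γ x) :=
    hγ.self_of_nhds.continuousAt.eventually (hG.eventually (by simp))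
  have h1 : deriv (fun x => G (γ x)) =ᶠ[nhds s] fun x => fderiv ℝ G (γ x) (γ' x) := by
    filter_upwards [hev, hγ] with x hx hγx
    exact ((hx.differentiableAt (by norm_num)).hasFDerivAt.comp_hasDerivAt x hγx).deriv
  rw [h1.deriv_eq]
  have hD : DifferentiableAt ℝ (fderiv ℝ G) (γ s) :=
    (hG.fderiv_right (m := 1) (by norm_num)).differentiableAt (by norm_num)
  exact ((hD.hasFDerivAt.comp_hasDerivAt s hγ.self_of_nhds).clm_apply hγ').deriv

/-- The one-dimensional wave operator of `G (a (t + r), b (t - r))` only involves the mixed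
second derivatives of `G`. -/
theorem wave_comp_null {G : ℝ × ℝ → ℝ} {a a' b b' : ℝ → ℝ} {a'' b'' t r : ℝ}
    (hG : ContDiffAt ℝ 2 G (a (t + r), b (t - r)))
    (ha : ∀ᶠ x in nhds (t + r), HasDerivAt a (a' x) x) (ha' : HasDerivAt a' a'' (t + r))
    (hb : ∀ᶠ x in nhds (t - r), HasDerivAt b (b' x) x) (hb' : HasDerivAt b' b'' (t - r)) :
    deriv (deriv fun s => G (a (s + r), b (s - r))) t -
        deriv (deriv fun s => G (a (t + s), b (t - s))) r =
      a' (t + r) * b' (t - r) *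
        (2 * (fderiv ℝ (fderiv ℝ G) (a (t + r), b (t - r)) (1, 0) (0, 1) +
          fderiv ℝ (fderiv ℝ G) (a (t + r), b (t - r)) (0, 1) (1, 0))) := by
  have e1 := deriv_deriv_comp (γ := fun s => (a (s + r), b (s - r)))
    (γ' := fun s => (a' (s + r), b' (s - r))) (γ'' := (a'', b'')) (s := t) hG
    (by
      filter_upwards [(by fun_prop : ContinuousAt (fun s => s + r) t).eventually ha,
        (by fun_prop : ContinuousAt (fun s => s - r) t).eventually hb] with x hx hy
      exact (hx.comp_add_const x r).prodMk (hy.comp_sub_const x r))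
    ((ha'.comp_add_const t r).prodMk (hb'.comp_sub_const t r))
  have e2 := deriv_deriv_comp (γ := fun s => (a (t + s), b (t - s)))
    (γ' := fun s => (a' (t + s), -b' (t - s))) (γ'' := (a'', b'')) (s := r) hG
    (by
      filter_upwards [(by fun_prop : ContinuousAt (fun s => t + s) r).eventually ha,
        (by fun_prop : ContinuousAt (fun s => t - s) r).eventually hb] with x hx hy
      exact (hx.comp_const_add t x).prodMk (hy.comp_const_sub t x))
    ((ha'.comp_const_add t r).prodMk (by simpa using (hb'.comp_const_sub t r).fun_neg))
  rw [e1, e2]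
  have hd (x y : ℝ) : (x, y) = x • ((1, 0) : ℝ × ℝ) + y • ((0, 1) : ℝ × ℝ) := by simp
  generalize fderiv ℝ (fderiv ℝ G) (a (t + r), b (t - r)) = B
  rw [hd (a' (t + r)) (b' (t - r)), hd (a' (t + r)) (-b' (t - r))]
  simp only [map_add, map_smul, add_apply, smul_apply, smul_eq_mul]
  ring

theorem deriv_deriv_id_mul {f : ℝ → ℝ} {x : ℝ} (hf : ContDiffAt ℝ 2 f x) :
    deriv (deriv fun s => s * f s) x = 2 * deriv f x + x * deriv (deriv f) x := by
  have h1 : deriv (fun s => s * f s) =ᶠ[nhds x] fun s => f s + s * deriv f s := by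
    filter_upwards [hf.eventually (by simp)] with s hs
    simpa using
      ((hasDerivAt_id s).fun_mul (hs.differentiableAt (by norm_num)).hasDerivAt).deriv
  rw [h1.deriv_eq]
  have hD : DifferentiableAt ℝ (deriv f) x :=
    ((hf.fderiv_right (m := 1) (by norm_num)).differentiableAt (by norm_num)).clm_apply
      (differentiableAt_const 1)
  have := ((hf.differentiableAt (by norm_num)).hasDerivAt.add
    ((hasDerivAt_id x).mul hD.hasDerivAt)).deriv
  simp only [id] at this
  refine this.trans ?_
  ring

theorem dAlembert_eq_wave_mul {f : ℝ → ℝ → ℝ} {t r : ℝ} (hr : r ≠ 0)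
    (hf : ContDiffAt ℝ 2 (f t) r) :
    dAlembert f t r =
      r⁻¹ * (deriv (deriv fun s => r * f s r) t - deriv (deriv fun s => s * f t s) r) := by
  have h1 : deriv (deriv fun s => r * f s r) t = r * deriv (deriv fun s => f s r) t := by
    simp only [deriv_const_mul_field']
  rw [h1, deriv_deriv_id_mul hf]
  change deriv (deriv fun s => f s r) t - deriv (deriv (f t)) r - 2 / r * deriv (f t) r = _
  field_simp
  ring

theorem PhiR_pos {p t r : ℝ} (hp : 2 < p) (hr : 0 < r) (hrt : r < t) : 0 < PhiR p t r := by
  have := Real.rpow_lt_rpow_of_neg (x := t - r) (y := t + r) (z := -(p - 2))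
    (by linarith) (by linarith) (by linarith)
  unfold PhiR
  linarith

theorem PhiR_lt_neg_PhiT {p t r : ℝ} (h : 0 < t + r) : PhiR p t r < -PhiT p t r := by
  have := Real.rpow_pos_of_pos h (-(p - 2))
  unfold PhiR PhiT
  linarith

/-- Conformal transformation of the radial d'Alembertian:
for `p > 2` and `h ∈ C²(K⁻)`, the function `Ω·(h∘Φ)` is `C²` on `K⁺`
(in null coordinates `0 < v < u`) and satisfies
`□(Ω·(h∘Φ)) = (p−2)²(uv)^{−(p−1)} Ω·((□h)∘Φ)` there. -/
theorem conformal_box_identity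
    (p : ℝ) (hp2 : 2 < p)
    (h : ℝ → ℝ → ℝ)
    (hreg : ContDiffOn ℝ 2 (fun q : ℝ × ℝ => h q.1 q.2)
      {q : ℝ × ℝ | 0 ≤ q.2 ∧ q.2 < -q.1}) :
    ContDiffOn ℝ 2
      (fun q : ℝ × ℝ => Omega p q.1 q.2 * h (PhiT p q.1 q.2) (PhiR p q.1 q.2))
      {q : ℝ × ℝ | 0 < q.2 ∧ q.2 < q.1} ∧
    ∀ t r : ℝ, 0 < r → r < t →
      dAlembert (fun t' r' => Omega p t' r' * h (PhiT p t' r') (PhiR p t' r')) t r =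
        (p - 2) ^ 2 * ((t + r) * (t - r)) ^ (-(p - 1)) * Omega p t r *
          dAlembert h (PhiT p t r) (PhiR p t r) := by
  have hh {T R : ℝ} (hR : 0 < R) (hT : R < -T) :
      ContDiffAt ℝ 2 (fun q : ℝ × ℝ => h q.1 q.2) (T, R) := by
    refine hreg.contDiffAt ?_
    filter_upwards [(isOpen_lt continuous_const continuous_snd).mem_nhds hR,
      (isOpen_lt continuous_snd continuous_fst.neg).mem_nhds hT] with q h1 h2
    exact ⟨le_of_lt h1, h2⟩
  have hcomp {t r : ℝ} (hr : 0 < r) (hrt : r < t) :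
      ContDiffAt ℝ 2 (fun q : ℝ × ℝ =>
        Omega p q.1 q.2 * h (PhiT p q.1 q.2) (PhiR p q.1 q.2)) (t, r) := by
    have hu : ContDiffAt ℝ 2 (fun q : ℝ × ℝ => (q.1 + q.2) ^ (-(p - 2))) (t, r) :=
      (contDiffAt_fst.add contDiffAt_snd).rpow_const_of_ne (by simp; linarith)
    have hv : ContDiffAt ℝ 2 (fun q : ℝ × ℝ => (q.1 - q.2) ^ (-(p - 2))) (t, r) :=
      (contDiffAt_fst.sub contDiffAt_snd).rpow_const_of_ne (by simp; linarith)
    have hT : ContDiffAt ℝ 2 (fun q : ℝ × ℝ => PhiT p q.1 q.2) (t, r) :=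
      (hu.neg.add hv.neg).div_const 2
    have hR : ContDiffAt ℝ 2 (fun q : ℝ × ℝ => PhiR p q.1 q.2) (t, r) :=
      (hu.neg.sub hv.neg).div_const 2
    have hΩ : ContDiffAt ℝ 2 (fun q : ℝ × ℝ => Omega p q.1 q.2) (t, r) :=
      (hv.sub hu).div (contDiffAt_const.mul contDiffAt_snd) (by simp; linarith)
    exact hΩ.mul (ContDiffAt.comp (t, r) (g := fun q : ℝ × ℝ => h q.1 q.2)
      (hh (PhiR_pos hp2 hr hrt) (PhiR_lt_neg_PhiT (by linarith))) (hT.prodMk hR))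
  refine ⟨fun q hq => (hcomp hq.1 hq.2).contDiffWithinAt, fun t r hr hrt => ?_⟩
  have hu : 0 < t + r := by linarith
  have hv : 0 < t - r := by linarith
  have hRpos := PhiR_pos hp2 hr hrt
  have hRT := PhiR_lt_neg_PhiT (p := p) hu
  have hhΦ := hh hRpos hRT
  set T := PhiT p t r with hTdef
  set R := PhiR p t r with hRdef
  let G : ℝ × ℝ → ℝ := fun q => (q.1 - q.2) / 2 * h ((q.1 + q.2) / 2) ((q.1 - q.2) / 2)
  let a : ℝ → ℝ := fun x => -x ^ (-(p - 2))
  let a' : ℝ → ℝ := fun x => (p - 2) * x ^ (-(p - 1))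
  have ha {x : ℝ} (hx : 0 < x) : HasDerivAt a (a' x) x := by
    refine (Real.hasDerivAt_rpow_const (p := -(p - 2)) (Or.inl hx.ne')).fun_neg.congr_deriv ?_
    simp only [a']
    rw [show -(p - 2) - 1 = -(p - 1) by ring]
    ring
  have ha' {x : ℝ} (hx : 0 < x) : HasDerivAt a' ((p - 2) * (-(p - 1) * x ^ (-(p - 1) - 1))) x :=
    (Real.hasDerivAt_rpow_const (Or.inl hx.ne')).const_mul _
  have hG : ContDiffAt ℝ 2 G (T + R, T - R) := by
    have hsub : ContDiffAt ℝ 2 (fun q : ℝ × ℝ => (q.1 - q.2) / 2) (T + R, T - R) := by fun_prop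
    have hadd : ContDiffAt ℝ 2 (fun q : ℝ × ℝ => (q.1 + q.2) / 2) (T + R, T - R) := by fun_prop
    refine hsub.mul (ContDiffAt.comp (T + R, T - R) (g := fun q : ℝ × ℝ => h q.1 q.2) ?_
      (hadd.prodMk hsub))
    convert hhΦ using 2 <;> ring
  have hTR : (a (t + r), a (t - r)) = (T + R, T - R) := by
    simp only [a, hTdef, hRdef, PhiT, PhiR, Prod.mk.injEq]
    constructor <;> ring
  have hGa (x y : ℝ) (hy : y ≠ 0) :
      y * (Omega p x y * h (PhiT p x y) (PhiR p x y)) = G (a (x + y), a (x - y)) := by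
    have : y * Omega p x y = PhiR p x y := by
      unfold Omega PhiR
      field_simp
      ring
    rw [← mul_assoc, this]
    rfl
  have hGid (x y : ℝ) : y * h x y = G (id (x + y), id (x - y)) := by
    simp only [G, id]
    ring_nf
  have e1 := wave_comp_null (hTR ▸ hG) (eventually_gt_nhds hu |>.mono fun x => ha) (ha' hu)
    (eventually_gt_nhds hv |>.mono fun x => ha) (ha' hv)
  have e2 := wave_comp_null (a := id) (b := id) (a' := fun _ => 1) (b' := fun _ => 1) hG
    (.of_forall hasDerivAt_id) (hasDerivAt_const _ _)
    (.of_forall hasDerivAt_id) (hasDerivAt_const _ _)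
  have hslice {f : ℝ → ℝ → ℝ} {x y : ℝ} (hf : ContDiffAt ℝ 2 (fun q : ℝ × ℝ => f q.1 q.2) (x, y)) :
      ContDiffAt ℝ 2 (f x) y :=
    ContDiffAt.comp y (g := fun q : ℝ × ℝ => f q.1 q.2) hf (contDiffAt_const.prodMk contDiffAt_id)
  have hev : (fun s => s * (Omega p t s * h (PhiT p t s) (PhiR p t s))) =ᶠ[nhds r]
      fun s => G (a (t + s), a (t - s)) := by
    filter_upwards [eventually_ne_nhds hr.ne'] with s hs using hGa t s hs
  rw [dAlembert_eq_wave_mul hr.ne' (hslice (hcomp hr hrt)),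
    dAlembert_eq_wave_mul hRpos.ne' (hslice hhΦ), hev.deriv.deriv_eq]
  simp only [hGa _ r hr.ne', hGid]
  rw [e1, e2, hTR]
  have hΩ : Omega p t r = r⁻¹ * R := by
    simp only [hRdef, Omega, PhiR]
    field_simp
    ring
  rw [hΩ, Real.mul_rpow hu.le hv.le]
  simp only [a', id]
  field_simp
end

section
/- Let p > 2 and let φ ∈ C²(K⁺) be a classical solution of □φ + φ|φ|^{p−1} = 0 on the forward light-cone K⁺. Then the conformally transformed function ψ := (Ω^{−1}·φ) ∘ Φ^{−1} ∈ C²(K⁻) is a classical solution on the backward light-cone K⁻ of the equation □ψ + (1/(p−2)²) [ (ũ − ṽ)/( (−ṽ)^{1/(p−2)} − (−ũ)^{1/(p−2)} ) ]^{p−1} ψ|ψ|^{p−1} = 0, where ũ, ṽ denote the null coordinates on K⁻ (ṽ < ũ < 0). -/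
/-- The conformally transformed function `ψ = (Ω⁻¹·φ) ∘ Φ⁻¹` on `K⁻`,
where `Φ⁻¹(ũ,ṽ) = ((−ũ)^{−1/(p−2)}, (−ṽ)^{−1/(p−2)})` in null coordinates
`ũ = t + r`, `ṽ = t − r` on `K⁻`. -/
noncomputable def psiOf (p : ℝ) (φ : ℝ → ℝ → ℝ) (t r : ℝ) : ℝ :=
  φ (((-(t + r)) ^ (-(1 / (p - 2))) + (-(t - r)) ^ (-(1 / (p - 2)))) / 2)
    (((-(t + r)) ^ (-(1 / (p - 2))) - (-(t - r)) ^ (-(1 / (p - 2)))) / 2) /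
  Omega p (((-(t + r)) ^ (-(1 / (p - 2))) + (-(t - r)) ^ (-(1 / (p - 2)))) / 2)
    (((-(t + r)) ^ (-(1 / (p - 2))) - (-(t - r)) ^ (-(1 / (p - 2)))) / 2)

open Filter Topology

/-- Second derivatives along lines: the derivative of `s ↦ fderiv g (c s) w`. -/
theorem hasDerivAt_fderiv_comp_apply {g : ℝ × ℝ → ℝ} {c : ℝ → ℝ × ℝ} {c' w : ℝ × ℝ} {s : ℝ}
    (hg : ContDiffAt ℝ 2 g (c s)) (hc : HasDerivAt c c' s) :
    HasDerivAt (fun x => fderiv ℝ g (c x) w) (fderiv ℝ (fderiv ℝ g) (c s) c' w) s := by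
  have h1 : DifferentiableAt ℝ (fderiv ℝ g) (c s) :=
    (hg.fderiv_right (m := 1) (by norm_num)).differentiableAt (by norm_num)
  have h2 := h1.hasFDerivAt.comp_hasDerivAt s hc
  simpa using h2.clm_apply (hasDerivAt_const s w)

theorem eventually_hasFDerivAt {g : ℝ × ℝ → ℝ} {q : ℝ × ℝ} (hg : ContDiffAt ℝ 2 g q) :
    ∀ᶠ z in 𝓝 q, HasFDerivAt g (fderiv ℝ g z) z := by
  filter_upwards [hg.eventually (by simp)] with z hz
  exact (hz.differentiableAt (by norm_num)).hasFDerivAt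

theorem hasDerivAt_pdr {G : ℝ → ℝ → ℝ} {u v : ℝ}
    (hG : ContDiffAt ℝ 2 (fun q : ℝ × ℝ => G q.1 q.2) (u, v)) :
    HasDerivAt (fun x => pdr G x v)
      (fderiv ℝ (fderiv ℝ (fun q : ℝ × ℝ => G q.1 q.2)) (u, v) (1, 0) (0, 1)) u := by
  have hc : HasDerivAt (fun x : ℝ => (x, v)) ((1 : ℝ), (0 : ℝ)) u :=
    (hasDerivAt_id u).prodMk (hasDerivAt_const u v)
  refine (hasDerivAt_fderiv_comp_apply (c := fun x => (x, v)) (w := (0, 1))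
    hG hc).congr_of_eventuallyEq ?_
  filter_upwards [hc.continuousAt.eventually (eventually_hasFDerivAt hG)] with x hx
  have hd : HasDerivAt (fun y : ℝ => (x, y)) ((0 : ℝ), (1 : ℝ)) v :=
    (hasDerivAt_const v x).prodMk (hasDerivAt_id v)
  exact (HasFDerivAt.comp_hasDerivAt (f := fun y : ℝ => (x, y)) v hx hd).deriv

/-- The mixed null derivative of a function whose arguments are reparametrized separately. -/
theorem pdt_pdr_comp {G : ℝ → ℝ → ℝ} {U V : ℝ → ℝ} {U' V' x y : ℝ}
    (hG : ContDiffAt ℝ 2 (fun q : ℝ × ℝ => G q.1 q.2) (U x, V y))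
    (hU : HasDerivAt U U' x) (hV : HasDerivAt V V' y) :
    pdt (pdr (fun a b => G (U a) (V b))) x y = U' * V' * pdt (pdr G) (U x) (V y) := by
  have h1 : (fun a => pdr (fun a b => G (U a) (V b)) a y) =ᶠ[𝓝 x]
      fun a => pdr G (U a) (V y) * V' := by
    have hc : ContinuousAt (fun a => (U a, V y)) x := hU.continuousAt.prodMk continuousAt_const
    filter_upwards [hc.eventually (eventually_hasFDerivAt hG)] with a ha
    have hd : HasDerivAt (fun z : ℝ => (U a, z)) ((0 : ℝ), (1 : ℝ)) (V y) :=
      (hasDerivAt_const _ _).prodMk (hasDerivAt_id _)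
    have hz : HasDerivAt (fun z => G (U a) z) _ (V y) :=
      HasFDerivAt.comp_hasDerivAt (f := fun z : ℝ => (U a, z)) _ ha hd
    have := (hz.differentiableAt.hasDerivAt.comp y hV).deriv
    exact this
  have h2 := ((hasDerivAt_pdr hG).differentiableAt.hasDerivAt.comp x hU).mul_const V'
  have h3 := (h2.congr_of_eventuallyEq h1).deriv
  unfold pdt
  rw [h3]
  ring

/-- In null coordinates, `r □f = 4 ∂_u ∂_v (r f)`. -/
theorem mul_dAlembert_eq {f G : ℝ → ℝ → ℝ} {t r : ℝ} (hr : r ≠ 0)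
    (hG : ContDiffAt ℝ 2 (fun q : ℝ × ℝ => G q.1 q.2) (t + r, t - r))
    (hf : ∀ᶠ q : ℝ × ℝ in 𝓝 (t, r), f q.1 q.2 = G (q.1 + q.2) (q.1 - q.2) / q.2) :
    r * dAlembert f t r = 4 * pdt (pdr G) (t + r) (t - r) := by
  set g : ℝ × ℝ → ℝ := fun q => G q.1 q.2 with hg
  set D := fderiv ℝ g with hD
  have hct (s ρ : ℝ) : HasDerivAt (fun x : ℝ => (x + ρ, x - ρ)) ((1 : ℝ), (1 : ℝ)) s :=
    ((hasDerivAt_id s).add_const ρ).prodMk ((hasDerivAt_id s).sub_const ρ)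
  have hcr (s ρ : ℝ) : HasDerivAt (fun x : ℝ => (s + x, s - x)) ((1 : ℝ), (-1 : ℝ)) ρ :=
    ((hasDerivAt_id ρ).const_add s).prodMk ((hasDerivAt_id ρ).const_sub s)
  have hnull : ContinuousAt (fun q : ℝ × ℝ => (q.1 + q.2, q.1 - q.2)) (t, r) := by fun_prop
  have hslt (s ρ : ℝ) : ContinuousAt (fun x : ℝ => (x, ρ)) s := by fun_prop
  have hslr (s ρ : ℝ) : ContinuousAt (fun x : ℝ => (s, x)) ρ := by fun_prop
  have hev : ∀ᶠ q : ℝ × ℝ in 𝓝 (t, r), q.2 ≠ 0 ∧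
      HasFDerivAt g (D (q.1 + q.2, q.1 - q.2)) (q.1 + q.2, q.1 - q.2) ∧
      ∀ᶠ z : ℝ × ℝ in 𝓝 q, f z.1 z.2 = G (z.1 + z.2) (z.1 - z.2) / z.2 :=
    (continuousAt_snd.eventually_ne hr).and
      ((hnull.eventually (eventually_hasFDerivAt hG)).and hf.eventually_nhds)
  have hpt : ∀ᶠ q : ℝ × ℝ in 𝓝 (t, r),
      pdt f q.1 q.2 = D (q.1 + q.2, q.1 - q.2) (1, 1) / q.2 := by
    filter_upwards [hev] with q hq
    obtain ⟨h0, hd, he⟩ := hq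
    have h1 := (HasFDerivAt.comp_hasDerivAt (f := fun x : ℝ => (x + q.2, x - q.2)) q.1 hd
      (hct q.1 q.2)).div_const q.2
    exact (h1.congr_of_eventuallyEq ((hslt q.1 q.2).eventually he)).deriv
  have hpr : ∀ᶠ q : ℝ × ℝ in 𝓝 (t, r),
      pdr f q.1 q.2 = (D (q.1 + q.2, q.1 - q.2) (1, -1) * q.2
        - g (q.1 + q.2, q.1 - q.2)) / q.2 ^ 2 := by
    filter_upwards [hev] with q hq
    obtain ⟨h0, hd, he⟩ := hq
    have h1 := (HasFDerivAt.comp_hasDerivAt (f := fun x : ℝ => (q.1 + x, q.1 - x)) q.2 hd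
      (hcr q.1 q.2)).div (hasDerivAt_id q.2) h0
    have h2 := (h1.congr_of_eventuallyEq ((hslr q.1 q.2).eventually he)).deriv
    simpa [pdr] using h2
  have htt : pdt (pdt f) t r = fderiv ℝ D (t + r, t - r) (1, 1) (1, 1) / r := by
    have h1 := (hasDerivAt_fderiv_comp_apply (c := fun x => (x + r, x - r))
      (w := (1, 1)) hG (hct t r)).div_const r
    exact (h1.congr_of_eventuallyEq ((hslt t r).eventually hpt)).deriv
  have hgd : HasFDerivAt g (D (t + r, t - r)) (t + r, t - r) :=
    (eventually_hasFDerivAt hG).self_of_nhds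
  have hrr : pdr (pdr f) t r = fderiv ℝ D (t + r, t - r) (1, -1) (1, -1) / r
      - 2 * D (t + r, t - r) (1, -1) / r ^ 2 + 2 * g (t + r, t - r) / r ^ 3 := by
    have h1 := (((hasDerivAt_fderiv_comp_apply (c := fun x => (t + x, t - x))
      (w := (1, -1)) hG (hcr t r)).mul
      (hasDerivAt_id r)).sub 
        (HasFDerivAt.comp_hasDerivAt (f := fun x : ℝ => (t + x, t - x)) r hgd (hcr t r))).div
      ((hasDerivAt_id r).pow 2) (pow_ne_zero 2 hr)
    have h2 := (h1.congr_of_eventuallyEq ((hslr t r).eventually hpr)).deriv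
    refine h2.trans ?_
    simp only [Pi.mul_apply, Pi.sub_apply, Pi.pow_apply, id, Function.comp_apply]
    field_simp
    push_cast
    ring
  have hr1 := hpr.self_of_nhds
  simp only at hr1
  have hmix : pdt (pdr G) (t + r) (t - r) = fderiv ℝ D (t + r, t - r) (1, 0) (0, 1) :=
    (hasDerivAt_pdr hG).deriv
  have hsymm : fderiv ℝ D (t + r, t - r) (1, 0) (0, 1) =
      fderiv ℝ D (t + r, t - r) (0, 1) (1, 0) :=
    (hG.isSymmSndFDerivAt (by simp)).eq _ _
  have e1 : ((1 : ℝ), (1 : ℝ)) = (1, 0) + (0, 1) := by simp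
  have e2 : ((1 : ℝ), (-1 : ℝ)) = (1, 0) - (0, 1) := by simp
  rw [dAlembert, htt, hrr, hr1, hmix, e1, e2]
  simp only [map_add, map_sub, add_apply, sub_apply]
  rw [← hsymm]
  field_simp
  ring

/-- The derivative of the null reparametrization `x ↦ (-x) ^ (-β)` defining `Φ⁻¹`. -/
theorem hasDerivAt_neg_rpow {x : ℝ} (β : ℝ) (hx : x < 0) :
    HasDerivAt (fun y : ℝ => (-y) ^ (-β)) (β * (-x) ^ (-β - 1)) x := by
  have h := (hasDerivAt_neg x).rpow_const (p := -β) (Or.inl (by linarith : -x ≠ 0))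
  convert h using 1
  ring

theorem neg_rpow_lt {β x y : ℝ} (hβ : 0 < β) (hyx : y < x) (hx : x < 0) :
    (-y) ^ (-β) < (-x) ^ (-β) :=
  Real.rpow_lt_rpow_of_neg (by linarith) (by linarith) (by linarith)

theorem neg_rpow_rpow_neg {p x : ℝ} (hp : 2 < p) (hx : x < 0) :
    ((-x) ^ (-(1 / (p - 2)))) ^ (-(p - 2)) = -x := by
  have : p - 2 ≠ 0 := by linarith
  rw [← Real.rpow_mul (by linarith)]
  have : -(1 / (p - 2)) * -(p - 2) = 1 := by field_simp
  rw [this, Real.rpow_one]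

/-- The conformal factor at `Φ⁻¹ (t, r)` is the quotient of the radii. -/
theorem Omega_comp_inverse {p t r : ℝ} (hp : 2 < p) (hr : 0 < r) (hrt : r < -t) :
    Omega p (((-(t + r)) ^ (-(1 / (p - 2))) + (-(t - r)) ^ (-(1 / (p - 2)))) / 2)
      (((-(t + r)) ^ (-(1 / (p - 2))) - (-(t - r)) ^ (-(1 / (p - 2)))) / 2) =
    r / (((-(t + r)) ^ (-(1 / (p - 2))) - (-(t - r)) ^ (-(1 / (p - 2)))) / 2) := by
  have h1 := neg_rpow_rpow_neg hp (x := t + r) (by linarith)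
  have h2 := neg_rpow_rpow_neg hp (x := t - r) (by linarith)
  set A := (-(t + r)) ^ (-(1 / (p - 2)))
  set B := (-(t - r)) ^ (-(1 / (p - 2)))
  rw [Omega, show (A + B) / 2 - (A - B) / 2 = B by ring,
    show (A + B) / 2 + (A - B) / 2 = A by ring, h1, h2,
    show -(t - r) - -(t + r) = 2 * r by ring, mul_div_mul_left _ _ two_ne_zero]

/-- The function `r φ` in null coordinates. -/
noncomputable def nullRadial (φ : ℝ → ℝ → ℝ) (u v : ℝ) : ℝ :=
  (u - v) / 2 * φ ((u + v) / 2) ((u - v) / 2)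

theorem psiOf_eq {p t r : ℝ} (φ : ℝ → ℝ → ℝ) (hp : 2 < p) (hr : 0 < r) (hrt : r < -t) :
    psiOf p φ t r = nullRadial φ ((-(t + r)) ^ (-(1 / (p - 2))))
      ((-(t - r)) ^ (-(1 / (p - 2)))) / r := by
  rw [psiOf, Omega_comp_inverse hp hr hrt, nullRadial, div_div_eq_mul_div, mul_comm]

theorem contDiffAt_nullRadial {φ : ℝ → ℝ → ℝ}
    (hφ : ContDiffOn ℝ 2 (fun q : ℝ × ℝ => φ q.1 q.2) {q : ℝ × ℝ | 0 ≤ q.2 ∧ q.2 < q.1})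
    {u v : ℝ} (hv : 0 < v) (hvu : v < u) :
    ContDiffAt ℝ 2 (fun q : ℝ × ℝ => nullRadial φ q.1 q.2) (u, v) := by
  have hmem : {q : ℝ × ℝ | 0 ≤ q.2 ∧ q.2 < q.1} ∈ 𝓝 ((u + v) / 2, (u - v) / 2) := by
    have ho : IsOpen {q : ℝ × ℝ | 0 < q.2 ∧ q.2 < q.1} :=
      (isOpen_lt continuous_const continuous_snd).inter (isOpen_lt continuous_snd continuous_fst)
    refine mem_of_superset (ho.mem_nhds ⟨?_, ?_⟩) fun q hq => ⟨hq.1.le, hq.2⟩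
    · simp only; linarith
    · simp only; linarith
  have h := hφ.contDiffAt hmem
  have hm : ContDiffAt ℝ 2 (fun q : ℝ × ℝ => ((q.1 + q.2) / 2, (q.1 - q.2) / 2)) (u, v) := by
    fun_prop
  have h3 : ContDiffAt ℝ 2 (fun q : ℝ × ℝ => (q.1 - q.2) / 2) (u, v) := by fun_prop
  exact h3.mul (ContDiffAt.comp (g := fun q : ℝ × ℝ => φ q.1 q.2) (u, v) h hm)

theorem contDiffAt_nullRadial_comp {φ : ℝ → ℝ → ℝ}
    (hφ : ContDiffOn ℝ 2 (fun q : ℝ × ℝ => φ q.1 q.2) {q : ℝ × ℝ | 0 ≤ q.2 ∧ q.2 < q.1})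
    {β x y : ℝ} (hβ : 0 < β) (hyx : y < x) (hx : x < 0) :
    ContDiffAt ℝ 2
      (fun q : ℝ × ℝ => nullRadial φ ((-q.1) ^ (-β)) ((-q.2) ^ (-β))) (x, y) := by
  have h := contDiffAt_nullRadial hφ (Real.rpow_pos_of_pos (by linarith : 0 < -y) (-β))
    (neg_rpow_lt hβ hyx hx)
  have h1 : ContDiffAt ℝ 2 (fun q : ℝ × ℝ => (-q.1) ^ (-β)) (x, y) :=
    contDiffAt_fst.neg.rpow_const_of_ne (by simp only; linarith)
  have h2 : ContDiffAt ℝ 2 (fun q : ℝ × ℝ => (-q.2) ^ (-β)) (x, y) :=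
    contDiffAt_snd.neg.rpow_const_of_ne (by simp only; linarith)
  exact ContDiffAt.comp (g := fun q : ℝ × ℝ => nullRadial φ q.1 q.2) (x, y) h (h1.prodMk h2)

theorem isOpen_backward_cone : IsOpen {q : ℝ × ℝ | 0 < q.2 ∧ q.2 < -q.1} :=
  (isOpen_lt continuous_const continuous_snd).inter
    (isOpen_lt continuous_snd continuous_fst.neg)

/-- The coefficient of the transformed nonlinearity, as a product of the Jacobian factors of `Φ⁻¹`
and a power of the conformal factor. -/
theorem coefficient_eq {p a b : ℝ} (hp : 2 < p) (ha : 0 < a) (hab : a < b) :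
    (1 / (p - 2) ^ 2) * ((b - a) / (b ^ (1 / (p - 2)) - a ^ (1 / (p - 2)))) ^ (p - 1) =
    (1 / (p - 2) * a ^ (-(1 / (p - 2)) - 1)) * (1 / (p - 2) * b ^ (-(1 / (p - 2)) - 1)) *
      ((b - a) / (a ^ (-(1 / (p - 2))) - b ^ (-(1 / (p - 2))))) ^ (p - 1) := by
  have hb : 0 < b := ha.trans hab
  have hα : 0 < p - 2 := by linarith
  have hβ : 0 < 1 / (p - 2) := by positivity
  have hk : 1 / (p - 2) * (p - 1) = 1 / (p - 2) + 1 := by field_simp; ring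
  set β := 1 / (p - 2) with hβd
  have hlt : a ^ β < b ^ β := Real.rpow_lt_rpow ha.le hab hβ
  have hA : 0 < a ^ β := Real.rpow_pos_of_pos ha β
  have hB : 0 < b ^ β := Real.rpow_pos_of_pos hb β
  have hq : (b - a) / (a ^ (-β) - b ^ (-β)) =
      (b - a) / (b ^ β - a ^ β) * (a ^ β * b ^ β) := by
    rw [Real.rpow_neg ha.le, Real.rpow_neg hb.le]
    have : b ^ β - a ^ β ≠ 0 := by linarith
    have h2 : (a ^ β)⁻¹ - (b ^ β)⁻¹ = (b ^ β - a ^ β) / (a ^ β * b ^ β) := by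
      field_simp
    rw [h2, div_div_eq_mul_div]
    ring
  have h0 : 0 ≤ (b - a) / (b ^ β - a ^ β) := div_nonneg (by linarith) (by linarith)
  have hinv (x : ℝ) (hx : 0 < x) : x ^ (-β - 1) * (x ^ β) ^ (p - 1) = 1 := by
    rw [← Real.rpow_mul hx.le, hk, ← Real.rpow_add hx]
    ring_nf
    exact Real.rpow_zero x
  rw [hq, Real.mul_rpow h0 (by positivity), Real.mul_rpow hA.le hB.le]
  have hsq : 1 / (p - 2) ^ 2 = β * β := by rw [hβd]; field_simp
  rw [hsq]
  linear_combination (-(β * β * ((b - a) / (b ^ β - a ^ β)) ^ (p - 1))) *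
    (a ^ (-β - 1) * (a ^ β) ^ (p - 1)) * hinv b hb
    - (β * β * ((b - a) / (b ^ β - a ^ β)) ^ (p - 1)) * hinv a ha

/-- If `φ ∈ C²(K⁺)` solves `□φ + φ|φ|^{p−1} = 0` on the
forward light-cone, then `ψ = (Ω⁻¹·φ)∘Φ⁻¹` is a `C²` classical solution on
the backward light-cone (in null coordinates `ṽ < ũ < 0`) of
`□ψ + (1/(p−2)²)[(ũ−ṽ)/((−ṽ)^{1/(p−2)} − (−ũ)^{1/(p−2)})]^{p−1} ψ|ψ|^{p−1} = 0`. -/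
theorem transformed_equation
    (p : ℝ) (hp2 : 2 < p)
    (φ : ℝ → ℝ → ℝ)
    (hφreg : ContDiffOn ℝ 2 (fun q : ℝ × ℝ => φ q.1 q.2)
      {q : ℝ × ℝ | 0 ≤ q.2 ∧ q.2 < q.1})
    (hsol : ∀ t r : ℝ, 0 < r → r < t →
      dAlembert φ t r + φ t r * |φ t r| ^ (p - 1) = 0) :
    ContDiffOn ℝ 2 (fun q : ℝ × ℝ => psiOf p φ q.1 q.2)
      {q : ℝ × ℝ | 0 < q.2 ∧ q.2 < -q.1} ∧
    ∀ t r : ℝ, 0 < r → r < -t →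
      dAlembert (psiOf p φ) t r +
        (1 / (p - 2) ^ 2) *
          (((t + r) - (t - r)) /
            ((-(t - r)) ^ (1 / (p - 2)) - (-(t + r)) ^ (1 / (p - 2)))) ^ (p - 1) *
          (psiOf p φ t r * |psiOf p φ t r| ^ (p - 1)) = 0 := by
  have hβ : 0 < 1 / (p - 2) := one_div_pos.mpr (by linarith)
  constructor
  · rintro ⟨t, r⟩ ⟨hr, hrt⟩
    simp only at hr hrt
    refine ContDiffAt.contDiffWithinAt ?_
    have h := contDiffAt_nullRadial_comp hφreg hβ (x := t + r) (y := t - r)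
      (by linarith) (by linarith)
    have hm : ContDiffAt ℝ 2 (fun q : ℝ × ℝ => (q.1 + q.2, q.1 - q.2)) (t, r) := by fun_prop
    refine ((ContDiffAt.comp (g := fun q : ℝ × ℝ => nullRadial φ ((-q.1) ^ (-(1 / (p - 2))))
      ((-q.2) ^ (-(1 / (p - 2))))) (t, r) h hm).div contDiffAt_snd hr.ne').congr_of_eventuallyEq ?_
    filter_upwards [isOpen_backward_cone.mem_nhds ⟨hr, hrt⟩] with q hq
    exact psiOf_eq φ hp2 hq.1 hq.2
  · intro t r hr hrt
    have hx : t + r < 0 := by linarith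
    have hy : t - r < 0 := by linarith
    have hyx : t - r < t + r := by linarith
    have hψ := mul_dAlembert_eq (f := psiOf p φ)
      (G := fun x y => nullRadial φ ((-x) ^ (-(1 / (p - 2)))) ((-y) ^ (-(1 / (p - 2))))) hr.ne'
      (contDiffAt_nullRadial_comp hφreg hβ hyx hx) (by
        filter_upwards [isOpen_backward_cone.mem_nhds ⟨hr, hrt⟩] with q hq
        exact psiOf_eq φ hp2 hq.1 hq.2)
    have hV0 : 0 < (-(t - r)) ^ (-(1 / (p - 2))) := Real.rpow_pos_of_pos (by linarith) _
    have hVU := neg_rpow_lt hβ hyx hx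
    have hG := contDiffAt_nullRadial hφreg hV0 hVU
    rw [pdt_pdr_comp (U := fun x => (-x) ^ (-(1 / (p - 2))))
      (V := fun y => (-y) ^ (-(1 / (p - 2)))) hG
      (hasDerivAt_neg_rpow _ hx) (hasDerivAt_neg_rpow _ hy)] at hψ
    have hval := psiOf_eq φ hp2 hr hrt
    have hcoef := coefficient_eq hp2 (a := -(t + r)) (b := -(t - r)) (by linarith) (by linarith)
    rw [show -(t - r) - -(t + r) = t + r - (t - r) by ring] at hcoef
    rw [hcoef]
    set U := (-(t + r)) ^ (-(1 / (p - 2)))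
    set V := (-(t - r)) ^ (-(1 / (p - 2)))
    have hR : 0 < (U - V) / 2 := by linarith
    have hφ := mul_dAlembert_eq (f := φ) (G := nullRadial φ) (t := (U + V) / 2)
      (r := (U - V) / 2) hR.ne' (by
        rwa [show (U + V) / 2 + (U - V) / 2 = U by ring,
          show (U + V) / 2 - (U - V) / 2 = V by ring]) (by
        filter_upwards [continuousAt_snd.eventually_ne hR.ne'] with q hq
        rw [nullRadial, show (q.1 + q.2 + (q.1 - q.2)) / 2 = q.1 by ring,
          show (q.1 + q.2 - (q.1 - q.2)) / 2 = q.2 by ring, mul_div_cancel_left₀ _ hq])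
    rw [show (U + V) / 2 + (U - V) / 2 = U by ring,
      show (U + V) / 2 - (U - V) / 2 = V by ring] at hφ
    have heq := hsol ((U + V) / 2) ((U - V) / 2) hR (by linarith)
    have hΩ : 0 < (t + r - (t - r)) / (U - V) := div_pos (by linarith) (by linarith)
    have hφψ : φ ((U + V) / 2) ((U - V) / 2) =
        (t + r - (t - r)) / (U - V) * psiOf p φ t r := by
      have hUV : U - V ≠ 0 := by linarith
      rw [hval, nullRadial]
      field_simp
      ring
    rw [hφψ, abs_mul, abs_of_pos hΩ, Real.mul_rpow hΩ.le (abs_nonneg _)] at heq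
    have hrR : r = (t + r - (t - r)) / (U - V) * ((U - V) / 2) := by
      have hUV : U - V ≠ 0 := by linarith
      field_simp
      ring
    refine (mul_eq_zero.mp ?_).resolve_left hr.ne'
    generalize psiOf p φ t r = ψ at *
    generalize ((t + r - (t - r)) / (U - V)) = Ω at *
    generalize (-(t + r)) ^ (-(1 / (p - 2)) - 1) = a at *
    generalize (-(t - r)) ^ (-(1 / (p - 2)) - 1) = b at *
    generalize |ψ| ^ (p - 1) = m at *
    generalize Ω ^ (p - 1) = k at *
    linear_combination hψ - (1 / (p - 2) * a * (1 / (p - 2) * b)) * hφ +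
      (1 / (p - 2) * a * (1 / (p - 2) * b)) * ((U - V) / 2) * heq +
      (1 / (p - 2) * a * (1 / (p - 2) * b)) * k * ψ * m * hrR
end

section
/- Let φ ∈ C²(K⁺) be a classical solution on the forward light-cone K⁺ of the cubic radial wave equation ∂_t²φ − ∂_r²φ − (2/r)∂_rφ + φ³ = 0. Then its conformal inversion ψ(t,r) := (1/(t² − r²)) φ( −t/(t² − r²), r/(t² − r²) ) is well-defined and of class C² on the backward light-cone K⁻ and is a classical solution of the same equation ∂_t²ψ − ∂_r²ψ − (2/r)∂_rψ + ψ³ = 0 on K⁻. -/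
/-- The conformal inversion of `φ`:
`ψ(t,r) = (1/(t²−r²)) φ(−t/(t²−r²), r/(t²−r²))`. -/
noncomputable def conformalInversion (φ : ℝ → ℝ → ℝ) (t r : ℝ) : ℝ :=
  (1 / (t ^ 2 - r ^ 2)) * φ (-t / (t ^ 2 - r ^ 2)) (r / (t ^ 2 - r ^ 2))

open Filter Topology

theorem pdt_eq_fderiv {F : ℝ → ℝ → ℝ} {p : ℝ × ℝ}
    (hF : DifferentiableAt ℝ (fun q : ℝ × ℝ => F q.1 q.2) p) :
    pdt F p.1 p.2 = fderiv ℝ (fun q : ℝ × ℝ => F q.1 q.2) p (1, 0) :=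
  (HasFDerivAt.comp_hasDerivAt (f := fun s => (s, p.2)) p.1 hF.hasFDerivAt
    ((hasDerivAt_id' p.1).prodMk (hasDerivAt_const p.1 p.2))).deriv

theorem pdr_eq_fderiv {F : ℝ → ℝ → ℝ} {p : ℝ × ℝ}
    (hF : DifferentiableAt ℝ (fun q : ℝ × ℝ => F q.1 q.2) p) :
    pdr F p.1 p.2 = fderiv ℝ (fun q : ℝ × ℝ => F q.1 q.2) p (0, 1) :=
  (HasFDerivAt.comp_hasDerivAt (f := fun s => (p.1, s)) p.2 hF.hasFDerivAt
    ((hasDerivAt_const p.2 p.1).prodMk (hasDerivAt_id' p.2))).deriv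

/-- Chain rule along a curve, in terms of the partial derivatives `pdt` and `pdr`. -/
theorem hasDerivAt_comp_curve {F : ℝ → ℝ → ℝ} {x y : ℝ → ℝ} {s x' y' : ℝ}
    (hF : DifferentiableAt ℝ (fun q : ℝ × ℝ => F q.1 q.2) (x s, y s))
    (hx : HasDerivAt x x' s) (hy : HasDerivAt y y' s) :
    HasDerivAt (fun u => F (x u) (y u))
      (pdt F (x s) (y s) * x' + pdr F (x s) (y s) * y') s := by
  have h := HasFDerivAt.comp_hasDerivAt (f := fun u => (x u, y u)) s hF.hasFDerivAt (hx.prodMk hy)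
  refine h.congr_deriv ?_
  have hxy : ((x', y') : ℝ × ℝ) = x' • (1, 0) + y' • (0, 1) := by simp
  rw [hxy, map_add, map_smul, map_smul, ← pdt_eq_fderiv hF, ← pdr_eq_fderiv hF, smul_eq_mul,
    smul_eq_mul]
  ring

/-- The partial derivatives of a `C²` function are differentiable, and the mixed second partial
derivatives agree. -/
theorem ContDiffAt.partials {F : ℝ → ℝ → ℝ} {p : ℝ × ℝ}
    (hF : ContDiffAt ℝ 2 (fun q : ℝ × ℝ => F q.1 q.2) p) :
    DifferentiableAt ℝ (fun q : ℝ × ℝ => pdt F q.1 q.2) p ∧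
    DifferentiableAt ℝ (fun q : ℝ × ℝ => pdr F q.1 q.2) p ∧
    pdr (pdt F) p.1 p.2 = pdt (pdr F) p.1 p.2 := by
  have hev : ∀ᶠ q in 𝓝 p, DifferentiableAt ℝ (fun q : ℝ × ℝ => F q.1 q.2) q :=
    (hF.eventually (by simp)).mono fun q hq => hq.differentiableAt (by simp)
  have hd : DifferentiableAt ℝ (fderiv ℝ (fun q : ℝ × ℝ => F q.1 q.2)) p :=
    (hF.fderiv_right (m := 1) (by norm_num)).differentiableAt (by simp)
  have e1 : (fun q : ℝ × ℝ => pdt F q.1 q.2) =ᶠ[𝓝 p]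
      fun q => fderiv ℝ (fun q : ℝ × ℝ => F q.1 q.2) q (1, 0) :=
    hev.mono fun q hq => pdt_eq_fderiv hq
  have e2 : (fun q : ℝ × ℝ => pdr F q.1 q.2) =ᶠ[𝓝 p]
      fun q => fderiv ℝ (fun q : ℝ × ℝ => F q.1 q.2) q (0, 1) :=
    hev.mono fun q hq => pdr_eq_fderiv hq
  have f1 := hd.hasFDerivAt.clm_apply (hasFDerivAt_const ((1, 0) : ℝ × ℝ) p)
  have f2 := hd.hasFDerivAt.clm_apply (hasFDerivAt_const ((0, 1) : ℝ × ℝ) p)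
  have d1 := f1.congr_of_eventuallyEq e1
  have d2 := f2.congr_of_eventuallyEq e2
  refine ⟨d1.differentiableAt, d2.differentiableAt, ?_⟩
  rw [pdr_eq_fderiv d1.differentiableAt, pdt_eq_fderiv d2.differentiableAt, d1.fderiv, d2.fderiv]
  have hs : IsSymmSndFDerivAt ℝ (fun q : ℝ × ℝ => F q.1 q.2) p :=
    hF.isSymmSndFDerivAt (by simp)
  simpa using hs.eq (0, 1) (1, 0)

theorem conformalInversion_mem_cone {t r : ℝ} (hr : 0 ≤ r) (h : r < -t) :
    0 < t ^ 2 - r ^ 2 ∧ 0 ≤ r / (t ^ 2 - r ^ 2) ∧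
      r / (t ^ 2 - r ^ 2) < -t / (t ^ 2 - r ^ 2) := by
  have hD : 0 < t ^ 2 - r ^ 2 := by nlinarith
  exact ⟨hD, by positivity, by gcongr⟩

theorem contDiffOn_conformalInversion {φ : ℝ → ℝ → ℝ}
    (hφ : ContDiffOn ℝ 2 (fun q : ℝ × ℝ => φ q.1 q.2) {q : ℝ × ℝ | 0 ≤ q.2 ∧ q.2 < q.1}) :
    ContDiffOn ℝ 2 (fun q : ℝ × ℝ => conformalInversion φ q.1 q.2)
      {q : ℝ × ℝ | 0 ≤ q.2 ∧ q.2 < -q.1} := by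
  have hD : ∀ q ∈ {q : ℝ × ℝ | 0 ≤ q.2 ∧ q.2 < -q.1}, q.1 ^ 2 - q.2 ^ 2 ≠ 0 :=
    fun q hq => (conformalInversion_mem_cone hq.1 hq.2).1.ne'
  have hden : ContDiffOn ℝ 2 (fun q : ℝ × ℝ => q.1 ^ 2 - q.2 ^ 2)
      {q : ℝ × ℝ | 0 ≤ q.2 ∧ q.2 < -q.1} := by fun_prop
  have h1 := (contDiff_fst (𝕜 := ℝ) (E := ℝ) (F := ℝ) (n := 2)).neg.contDiffOn.div hden hD
  have h2 := (contDiff_snd (𝕜 := ℝ) (E := ℝ) (F := ℝ) (n := 2)).contDiffOn.div hden hD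
  exact (contDiffOn_const.div hden hD).mul
    (hφ.comp (h1.prodMk h2) fun q hq => (conformalInversion_mem_cone hq.1 hq.2).2)

theorem hasDerivAt_conformalInversion_time {φ : ℝ → ℝ → ℝ} {t r : ℝ} (hD : t ^ 2 - r ^ 2 ≠ 0)
    (hφ : DifferentiableAt ℝ (fun q : ℝ × ℝ => φ q.1 q.2)
      (-t / (t ^ 2 - r ^ 2), r / (t ^ 2 - r ^ 2))) :
    HasDerivAt (fun s => conformalInversion φ s r)
      (-(2 * t) / (t ^ 2 - r ^ 2) * conformalInversion φ t r
        + (t ^ 2 + r ^ 2) / (t ^ 2 - r ^ 2) ^ 2 * conformalInversion (pdt φ) t r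
        - 2 * t * r / (t ^ 2 - r ^ 2) ^ 2 * conformalInversion (pdr φ) t r) t := by
  have hd : HasDerivAt (fun s : ℝ => s ^ 2 - r ^ 2) (2 * t) t := by
    simpa using (hasDerivAt_pow 2 t).sub_const (r ^ 2)
  have hx := (hasDerivAt_id t).neg.fun_div hd hD
  have hy := (hasDerivAt_const t r).fun_div hd hD
  have h1 := (hasDerivAt_const t (1 : ℝ)).fun_div hd hD
  refine (h1.fun_mul (hasDerivAt_comp_curve hφ hx hy)).congr_deriv ?_
  simp only [conformalInversion, Pi.neg_apply, id]
  field_simp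
  ring

theorem hasDerivAt_conformalInversion_radius {φ : ℝ → ℝ → ℝ} {t r : ℝ} (hD : t ^ 2 - r ^ 2 ≠ 0)
    (hφ : DifferentiableAt ℝ (fun q : ℝ × ℝ => φ q.1 q.2)
      (-t / (t ^ 2 - r ^ 2), r / (t ^ 2 - r ^ 2))) :
    HasDerivAt (fun s => conformalInversion φ t s)
      (2 * r / (t ^ 2 - r ^ 2) * conformalInversion φ t r
        - 2 * t * r / (t ^ 2 - r ^ 2) ^ 2 * conformalInversion (pdt φ) t r
        + (t ^ 2 + r ^ 2) / (t ^ 2 - r ^ 2) ^ 2 * conformalInversion (pdr φ) t r) r := by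
  have hd : HasDerivAt (fun s : ℝ => t ^ 2 - s ^ 2) (-(2 * r)) r := by
    simpa using (hasDerivAt_pow 2 r).const_sub (t ^ 2)
  have hx := (hasDerivAt_const r (-t)).fun_div hd hD
  have hy := (hasDerivAt_id r).fun_div hd hD
  have h1 := (hasDerivAt_const r (1 : ℝ)).fun_div hd hD
  refine (h1.fun_mul (hasDerivAt_comp_curve hφ hx hy)).congr_deriv ?_
  simp only [conformalInversion, id]
  field_simp
  ring

/-- Conformal covariance of the radial d'Alembertian. -/
theorem dAlembert_conformalInversion {φ : ℝ → ℝ → ℝ}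
    (hφ : ContDiffOn ℝ 2 (fun q : ℝ × ℝ => φ q.1 q.2) {q : ℝ × ℝ | 0 ≤ q.2 ∧ q.2 < q.1})
    {t r : ℝ} (hr : 0 < r) (hrt : r < -t) :
    dAlembert (conformalInversion φ) t r =
      (1 / (t ^ 2 - r ^ 2)) ^ 3 *
        dAlembert φ (-t / (t ^ 2 - r ^ 2)) (r / (t ^ 2 - r ^ 2)) := by
  have hC : ∀ {a b : ℝ}, 0 < b → b < a → ContDiffAt ℝ 2 (fun q : ℝ × ℝ => φ q.1 q.2) (a, b) := by
    intro a b hb hba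
    refine hφ.contDiffAt (mem_of_superset (((isOpen_lt continuous_const continuous_snd).inter
      (isOpen_lt continuous_snd continuous_fst)).mem_nhds
        (⟨hb, hba⟩ : (a, b) ∈ {q : ℝ × ℝ | 0 < q.2} ∩ {q : ℝ × ℝ | q.2 < q.1})) ?_)
    exact fun q hq => ⟨le_of_lt hq.1, hq.2⟩
  have hI : ∀ {t r : ℝ}, 0 < r → r < -t → ContDiffAt ℝ 2 (fun q : ℝ × ℝ => φ q.1 q.2)
      (-t / (t ^ 2 - r ^ 2), r / (t ^ 2 - r ^ 2)) := fun hr h =>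
    hC (div_pos hr (conformalInversion_mem_cone hr.le h).1) (conformalInversion_mem_cone hr.le h).2.2
  have hD : t ^ 2 - r ^ 2 ≠ 0 := (conformalInversion_mem_cone hr.le hrt).1.ne'
  have hdiff := (hI hr hrt).differentiableAt (by simp)
  obtain ⟨hdt, hdr, hsymm⟩ := (hI hr hrt).partials
  have et : (fun s => pdt (conformalInversion φ) s r) =ᶠ[𝓝 t] fun s =>
      -(2 * s) / (s ^ 2 - r ^ 2) * conformalInversion φ s r
        + (s ^ 2 + r ^ 2) / (s ^ 2 - r ^ 2) ^ 2 * conformalInversion (pdt φ) s r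
        - 2 * s * r / (s ^ 2 - r ^ 2) ^ 2 * conformalInversion (pdr φ) s r := by
    filter_upwards [eventually_lt_nhds (show t < -r by linarith)] with s hs
    have hs' : r < -s := by linarith
    exact (hasDerivAt_conformalInversion_time (conformalInversion_mem_cone hr.le hs').1.ne'
      ((hI hr hs').differentiableAt (by simp))).deriv
  have er : (fun s => pdr (conformalInversion φ) t s) =ᶠ[𝓝 r] fun s =>
      2 * s / (t ^ 2 - s ^ 2) * conformalInversion φ t s
        - 2 * t * s / (t ^ 2 - s ^ 2) ^ 2 * conformalInversion (pdt φ) t s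
        + (t ^ 2 + s ^ 2) / (t ^ 2 - s ^ 2) ^ 2 * conformalInversion (pdr φ) t s := by
    filter_upwards [eventually_lt_nhds hrt, eventually_gt_nhds hr] with s hs hs0
    exact (hasDerivAt_conformalInversion_radius (conformalInversion_mem_cone hs0.le hs).1.ne'
      ((hI hs0 hs).differentiableAt (by simp))).deriv
  have hd2 : ∀ {d : ℝ → ℝ} {d' u : ℝ}, HasDerivAt d d' u →
      HasDerivAt (fun s => d s ^ 2) (2 * d u * d') u := fun h => by simpa using h.fun_pow 2
  have htt := by
    have hd : HasDerivAt (fun s : ℝ => s ^ 2 - r ^ 2) (2 * t) t := by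
      simpa using (hasDerivAt_pow 2 t).sub_const (r ^ 2)
    have hn1 : HasDerivAt (fun s : ℝ => -(2 * s)) (-2) t := by
      simpa using ((hasDerivAt_id t).const_mul (2 : ℝ)).fun_neg
    have hn2 : HasDerivAt (fun s : ℝ => s ^ 2 + r ^ 2) (2 * t) t := by
      simpa using (hasDerivAt_pow 2 t).add_const (r ^ 2)
    have hn3 : HasDerivAt (fun s : ℝ => 2 * s * r) (2 * r) t := by
      simpa using ((hasDerivAt_id t).const_mul (2 : ℝ)).mul_const r
    exact ((((hn1.fun_div hd hD).fun_mul (hasDerivAt_conformalInversion_time hD hdiff)).fun_add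
      ((hn2.fun_div (hd2 hd) (pow_ne_zero 2 hD)).fun_mul
        (hasDerivAt_conformalInversion_time hD hdt))).fun_sub
      ((hn3.fun_div (hd2 hd) (pow_ne_zero 2 hD)).fun_mul
        (hasDerivAt_conformalInversion_time hD hdr))).deriv
  have hrr := by
    have hd : HasDerivAt (fun s : ℝ => t ^ 2 - s ^ 2) (-(2 * r)) r := by
      simpa using (hasDerivAt_pow 2 r).const_sub (t ^ 2)
    have hn1 : HasDerivAt (fun s : ℝ => 2 * s) 2 r := by
      simpa using (hasDerivAt_id r).const_mul (2 : ℝ)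
    have hn2 : HasDerivAt (fun s : ℝ => 2 * t * s) (2 * t) r := by
      simpa using (hasDerivAt_id r).const_mul (2 * t)
    have hn3 : HasDerivAt (fun s : ℝ => t ^ 2 + s ^ 2) (2 * r) r := by
      simpa using (hasDerivAt_pow 2 r).const_add (t ^ 2)
    exact ((((hn1.fun_div hd hD).fun_mul (hasDerivAt_conformalInversion_radius hD hdiff)).fun_sub
      ((hn2.fun_div (hd2 hd) (pow_ne_zero 2 hD)).fun_mul
        (hasDerivAt_conformalInversion_radius hD hdt))).fun_add
      ((hn3.fun_div (hd2 hd) (pow_ne_zero 2 hD)).fun_mul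
        (hasDerivAt_conformalInversion_radius hD hdr))).deriv
  have hr1 : pdr (conformalInversion φ) t r = _ :=
    (hasDerivAt_conformalInversion_radius hD hdiff).deriv
  have htt' := et.deriv_eq.trans htt
  have hrr' := er.deriv_eq.trans hrr
  change pdt (pdt (conformalInversion φ)) t r = _ at htt'
  change pdr (pdr (conformalInversion φ)) t r = _ at hrr'
  have hr0 := hr.ne'
  rw [dAlembert, htt', hrr', hr1]
  simp only [conformalInversion, dAlembert] at hsymm ⊢
  rw [hsymm]
  generalize pdt (pdt φ) _ _ = a
  generalize pdr (pdr φ) _ _ = b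
  generalize pdt (pdr φ) _ _ = c
  generalize pdt φ _ _ = d
  generalize pdr φ _ _ = e
  generalize φ _ _ = f
  field_simp
  ring

/-- Conformal inversion invariance of the cubic radial wave
equation: if `φ ∈ C²(K⁺)` solves `∂_t²φ − ∂_r²φ − (2/r)∂_rφ + φ³ = 0` on the
forward light-cone `K⁺ = {0 ≤ r < t}`, then
`ψ(t,r) = (1/(t²−r²)) φ(−t/(t²−r²), r/(t²−r²))` is well-defined, of class `C²`
on the backward light-cone `K⁻ = {0 ≤ r < −t}`, and solves the same equation
there. -/
theorem cubic_conformal_inversion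
    (φ : ℝ → ℝ → ℝ)
    (hφreg : ContDiffOn ℝ 2 (fun q : ℝ × ℝ => φ q.1 q.2)
      {q : ℝ × ℝ | 0 ≤ q.2 ∧ q.2 < q.1})
    (hsol : ∀ t r : ℝ, 0 < r → r < t →
      dAlembert φ t r + (φ t r) ^ 3 = 0) :
    ContDiffOn ℝ 2 (fun q : ℝ × ℝ => conformalInversion φ q.1 q.2)
      {q : ℝ × ℝ | 0 ≤ q.2 ∧ q.2 < -q.1} ∧
    ∀ t r : ℝ, 0 < r → r < -t →
      dAlembert (conformalInversion φ) t r + (conformalInversion φ t r) ^ 3 = 0 := by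
  refine ⟨contDiffOn_conformalInversion hφreg, fun t r hr hrt => ?_⟩
  obtain ⟨hD, -, hlt⟩ := conformalInversion_mem_cone hr.le hrt
  rw [dAlembert_conformalInversion hφreg hr hrt, conformalInversion, mul_pow, ← mul_add,
    hsol _ _ (div_pos hr hD) hlt, mul_zero]
end

section
/- Let p ≥ 3 and define g(ũ,ṽ) := (ũ − ṽ)/( (−ṽ)^{1/(p−2)} − (−ũ)^{1/(p−2)} ) for ṽ < ũ < 0. Then the time derivative of g is non-positive: (∂_ũ + ∂_ṽ) g(ũ,ṽ) ≤ 0 for all ṽ < ũ < 0. Equivalently, for each fixed r > 0 the function t ↦ g(t + r, t − r) is non-increasing on its domain {t < −r}; hence the coefficient c := (1/(p−2)²) g^{p−1} satisfies ∂_t c ≤ 0 on the backward light-cone. -/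
/-- The function `g(ũ,ṽ) = (ũ−ṽ)/((−ṽ)^{1/(p−2)} − (−ũ)^{1/(p−2)})` in null
coordinates on the backward light-cone (`ṽ < ũ < 0`). -/
noncomputable def gFun (p tu tv : ℝ) : ℝ :=
  (tu - tv) / ((-tv) ^ (1 / (p - 2)) - (-tu) ^ (1 / (p - 2)))

/-- Positivity of the denominator of `gFun`. -/
theorem rpow_neg_sub_rpow_neg_pos {q x y : ℝ} (hq : 0 < q) (hxy : y < x) (hx : x < 0) :
    0 < (-y) ^ q - (-x) ^ q :=
  sub_pos.2 (Real.rpow_lt_rpow (by linarith) (by linarith) hq)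

theorem gFun_pos {p x y : ℝ} (hp : 2 < p) (hxy : y < x) (hx : x < 0) : 0 < gFun p x y :=
  div_pos (sub_pos.2 hxy)
    (rpow_neg_sub_rpow_neg_pos (one_div_pos.2 (by linarith)) hxy hx)

/-- Derivative of `gFun` along a curve in the region `ṽ < ũ < 0`. -/
theorem HasDerivAt.gFun {p u v s : ℝ} {x y : ℝ → ℝ} (hp : 2 < p)
    (hu : HasDerivAt x u s) (hv : HasDerivAt y v s) (hxy : y s < x s) (hx : x s < 0) :
    HasDerivAt (fun s => gFun p (x s) (y s))
      (((u - v) * ((-y s) ^ (1 / (p - 2)) - (-x s) ^ (1 / (p - 2))) -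
        (x s - y s) * (-v * (1 / (p - 2)) * (-y s) ^ (1 / (p - 2) - 1) -
          -u * (1 / (p - 2)) * (-x s) ^ (1 / (p - 2) - 1))) /
        ((-y s) ^ (1 / (p - 2)) - (-x s) ^ (1 / (p - 2))) ^ 2) s :=
  (hu.fun_sub hv).fun_div
    ((hv.fun_neg.rpow_const (Or.inl (by linarith))).fun_sub
      (hu.fun_neg.rpow_const (Or.inl (by linarith))))
    (rpow_neg_sub_rpow_neg_pos (one_div_pos.2 (by linarith)) hxy hx).ne'

/-- The sum of the two partial derivatives of `gFun` is non-positive, as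
`z ↦ z ^ (1 / (p - 2) - 1)` is non-increasing on the positive reals, and it is the
derivative of `gFun` in the diagonal direction. -/
theorem deriv_gFun_add_nonpos_and_hasDerivAt {p x y : ℝ} (hp : 3 ≤ p) (hxy : y < x) (hx : x < 0) :
    deriv (fun z => gFun p z y) x + deriv (fun z => gFun p x z) y ≤ 0 ∧
      HasDerivAt (fun h => gFun p (x + h) (y + h))
        (deriv (fun z => gFun p z y) x + deriv (fun z => gFun p x z) y) 0 := by
  have hp2 : 2 < p := by linarith
  have hx' := (hasDerivAt_id x).gFun hp2 (hasDerivAt_const x y) hxy hx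
  have hy' := (hasDerivAt_const y x).gFun hp2 (hasDerivAt_id y) hxy hx
  have ht' := ((hasDerivAt_id (0 : ℝ)).const_add x).gFun hp2
    ((hasDerivAt_id (0 : ℝ)).const_add y) (by simpa using hxy) (by simpa using hx)
  simp only [id] at hx' hy' ht'
  rw [hx'.deriv, hy'.deriv]
  simp only [add_zero] at ht'
  have hD := rpow_neg_sub_rpow_neg_pos
    (one_div_pos.2 (by linarith) : (0 : ℝ) < 1 / (p - 2)) hxy hx
  have hq : 0 < 1 / (p - 2) := one_div_pos.2 (by linarith)
  have hq1 : 1 / (p - 2) ≤ 1 := (div_le_one (by linarith)).2 (by linarith)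
  have hmono : (-y) ^ (1 / (p - 2) - 1) ≤ (-x) ^ (1 / (p - 2) - 1) :=
    Real.rpow_le_rpow_of_nonpos (by linarith) (by linarith) (by linarith)
  constructor
  · rw [← add_div]
    refine div_nonpos_of_nonpos_of_nonneg ?_ (sq_nonneg _)
    have := mul_nonneg (mul_nonneg (sub_pos.2 hxy).le hq.le) (sub_nonneg.2 hmono)
    linarith
  · convert ht' using 1
    rw [← add_div]
    ring

theorem antitoneOn_gFun {p r : ℝ} (hp : 3 ≤ p) (hr : 0 < r) :
    AntitoneOn (fun t => gFun p (t + r) (t - r)) (Set.Iio (-r)) := by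
  have key : ∀ t ∈ Set.Iio (-r), ∃ d ≤ 0,
      HasDerivAt (fun t => gFun p (t + r) (t - r)) d t := by
    intro t ht
    have ht : t < -r := ht
    obtain ⟨hd, h⟩ := deriv_gFun_add_nonpos_and_hasDerivAt (x := t + r) (y := t - r) hp
      (by linarith) (by linarith)
    refine ⟨_, hd, ?_⟩
    rw [← sub_self t] at h
    have hshift : (fun s => gFun p (s + r) (s - r)) =
        fun s => gFun p (t + r + (s - t)) (t - r + (s - t)) := by
      funext s
      congr 1 <;> ring
    rw [hshift]
    exact h.comp_sub_const t t
  refine antitoneOn_of_deriv_nonpos (convex_Iio _) (fun t ht => ?_) (fun t ht => ?_) (fun t ht => ?_)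
  · obtain ⟨d, -, h⟩ := key t ht
    exact h.continuousAt.continuousWithinAt
  · obtain ⟨d, -, h⟩ := key t (interior_subset ht)
    exact h.differentiableAt.differentiableWithinAt
  · obtain ⟨d, hd, h⟩ := key t (interior_subset ht)
    rwa [h.deriv]

/-- Monotonicity of the coefficient in time: for `p ≥ 3`
one has `(∂_ũ + ∂_ṽ)g ≤ 0` for all `ṽ < ũ < 0`; equivalently, for each fixed
`r > 0` the function `t ↦ g(t+r, t−r)` is non-increasing on `{t < −r}`;
hence `c = (1/(p−2)²) g^{p−1}` satisfies `∂_t c ≤ 0` on the backward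
light-cone. -/
theorem coefficient_time_monotone (p : ℝ) (hp3 : 3 ≤ p) :
    (∀ tu tv : ℝ, tv < tu → tu < 0 →
      deriv (fun x => gFun p x tv) tu + deriv (fun y => gFun p tu y) tv ≤ 0) ∧
    (∀ r : ℝ, 0 < r →
      AntitoneOn (fun t => gFun p (t + r) (t - r)) (Set.Iio (-r))) ∧
    ∀ r : ℝ, 0 < r → ∀ t : ℝ, t < -r →
      deriv (fun s => (1 / (p - 2) ^ 2) * gFun p (s + r) (s - r) ^ (p - 1)) t ≤ 0 := by
  refine ⟨fun tu tv h h0 => (deriv_gFun_add_nonpos_and_hasDerivAt hp3 h h0).1,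
    fun r hr => antitoneOn_gFun hp3 hr, fun r hr t ht => ?_⟩
  have hanti : AntitoneOn (fun s => (1 / (p - 2) ^ 2) * gFun p (s + r) (s - r) ^ (p - 1))
      (Set.Iio (-r)) := fun a ha b hb hab => by
    have hb' : b < -r := hb
    exact mul_le_mul_of_nonneg_left
      (Real.rpow_le_rpow (gFun_pos (by linarith) (by linarith) (by linarith)).le
        (antitoneOn_gFun hp3 hr ha hb hab) (by linarith)) (by positivity)
  rw [← derivWithin_of_mem_nhds (Iio_mem_nhds ht)]
  exact hanti.derivWithin_nonpos
end
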